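/- arXiv:2510.01580 — 2 statements merged into one kernel-verified Lean document; each statement's English description precedes it below -/
import Mathlib

section
/- If some subinterval [t_1, t_2) with t₀ ≤ t_1 < t_2 ≤ t_d is weakly defected, then ‖Φ(t_d, t₀)‖ < 1 in the maximum absolute row-sum norm. -/
open Matrix Finset Filter

noncomputable section

/-- Maximum absolute row-sum norm of a matrix. -/
noncomputable def rowNorm {n : ℕ} (A : Matrix (Fin n) (Fin n) ℝ) : ℝ :=
  ⨆ i, ∑ j, |A i j|

/-- Auxiliary product: `PhiAux lam W τ k = Λ(τ+k-1)W(τ+k-1) ⋯ Λ(τ)W(τ)`. -/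
noncomputable def PhiAux {n : ℕ} (lam : ℕ → Fin n → ℝ)
    (W : ℕ → Matrix (Fin n) (Fin n) ℝ) (τ : ℕ) : ℕ → Matrix (Fin n) (Fin n) ℝ
  | 0 => 1
  | k + 1 => (Matrix.diagonal (lam (τ + k)) * W (τ + k)) * PhiAux lam W τ k

/-- State-transition matrix `Φ(t,τ) = Λ(t−1)W(t−1) ⋯ Λ(τ)W(τ)`, `Φ(τ,τ) = I`. -/
noncomputable def Phi {n : ℕ} (lam : ℕ → Fin n → ℝ)
    (W : ℕ → Matrix (Fin n) (Fin n) ℝ) (t τ : ℕ) : Matrix (Fin n) (Fin n) ℝ :=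
  PhiAux lam W τ (t - τ)

/-- The interval `[t0, td)` is weakly defected: every agent `i` is reached by a
temporal s-path from a stubborn source. -/
def IsWeaklyDefected {n : ℕ} (lam : ℕ → Fin n → ℝ) (W : ℕ → Matrix (Fin n) (Fin n) ℝ)
    (t0 td : ℕ) : Prop :=
  ∀ i : Fin n, ∃ τ : ℕ, t0 ≤ τ ∧ τ < td ∧ ∃ a : ℕ → Fin n, a td = i ∧
    lam τ (a (τ + 1)) < 1 ∧
    ∀ k, τ + 1 ≤ k → k + 1 ≤ td → 0 < W k (a (k + 1)) (a k)

/-- A weighted average of numbers at most one is less than one as soon as some number carrying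
positive weight is less than one. -/
lemma sum_mul_lt_one {ι : Type*} [Fintype ι] {w x : ι → ℝ} (hw0 : ∀ j, 0 ≤ w j)
    (hw1 : ∑ j, w j = 1) (hx : ∀ j, x j ≤ 1) {j : ι} (hwj : 0 < w j) (hxj : x j < 1) :
    ∑ j, w j * x j < 1 := by
  rw [← hw1]
  exact Finset.sum_lt_sum (fun k _ => mul_le_of_le_one_right (hw0 k) (hx k))
    ⟨j, Finset.mem_univ j, mul_lt_of_lt_one_right hwj hxj⟩

lemma Phi_self {n : ℕ} (lam : ℕ → Fin n → ℝ) (W : ℕ → Matrix (Fin n) (Fin n) ℝ) (t : ℕ) :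
    Phi lam W t t = 1 := by
  simp [Phi, PhiAux]

lemma Phi_succ {n : ℕ} (lam : ℕ → Fin n → ℝ) (W : ℕ → Matrix (Fin n) (Fin n) ℝ) {t τ : ℕ}
    (h : τ ≤ t) :
    Phi lam W (t + 1) τ = (Matrix.diagonal (lam t) * W t) * Phi lam W t τ := by
  obtain ⟨k, rfl⟩ := Nat.exists_eq_add_of_le h
  simp [Phi, add_assoc, PhiAux]

lemma sum_Phi_succ {n : ℕ} (lam : ℕ → Fin n → ℝ) (W : ℕ → Matrix (Fin n) (Fin n) ℝ) {t τ : ℕ}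
    (h : τ ≤ t) (i : Fin n) :
    ∑ j, Phi lam W (t + 1) τ i j = lam t i * ∑ k, W t i k * ∑ j, Phi lam W t τ k j := by
  simp only [Phi_succ lam W h, Matrix.mul_assoc, Matrix.diagonal_mul, ← Finset.mul_sum]
  simp only [Matrix.mul_apply, Finset.mul_sum]
  rw [Finset.sum_comm]

section Stochastic

variable {n : ℕ} {lam : ℕ → Fin n → ℝ} {W : ℕ → Matrix (Fin n) (Fin n) ℝ}

lemma Phi_nonneg (hW0 : ∀ t i j, 0 ≤ W t i j) (hlam : ∀ t i, 0 ≤ lam t i) {t τ : ℕ} (h : τ ≤ t)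
    (i j : Fin n) : 0 ≤ Phi lam W t τ i j := by
  induction t, h using Nat.le_induction generalizing i j with
  | base =>
    rw [Phi_self, Matrix.one_apply]
    split_ifs <;> norm_num
  | succ t h ih =>
    rw [Phi_succ lam W h, Matrix.mul_assoc, Matrix.diagonal_mul, Matrix.mul_apply]
    exact mul_nonneg (hlam t i) (Finset.sum_nonneg fun k _ => mul_nonneg (hW0 t i k) (ih k j))

lemma sum_Phi_le_one (hW0 : ∀ t i j, 0 ≤ W t i j) (hW1 : ∀ t i, ∑ j, W t i j = 1)
    (hlam : ∀ t i, 0 ≤ lam t i ∧ lam t i ≤ 1) {t τ : ℕ} (h : τ ≤ t) (i : Fin n) :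
    ∑ j, Phi lam W t τ i j ≤ 1 := by
  induction t, h using Nat.le_induction generalizing i with
  | base => simp [Phi_self, Matrix.one_apply]
  | succ t h ih =>
    rw [sum_Phi_succ lam W h]
    refine mul_le_one₀ (hlam t i).2 (Finset.sum_nonneg fun k _ => mul_nonneg (hW0 t i k)
      (Finset.sum_nonneg fun j _ => Phi_nonneg hW0 (fun t i => (hlam t i).1) h k j)) ?_
    rw [← hW1 t i]
    exact Finset.sum_le_sum fun k _ => mul_le_of_le_one_right (hW0 t i k) (ih k)

/-- A defect of a row sum is inherited along an edge of positive weight. -/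
lemma sum_Phi_succ_lt_one (hW0 : ∀ t i j, 0 ≤ W t i j) (hW1 : ∀ t i, ∑ j, W t i j = 1)
    (hlam : ∀ t i, 0 ≤ lam t i ∧ lam t i ≤ 1) {t τ : ℕ} (h : τ ≤ t) {i k : Fin n}
    (hik : 0 < W t i k) (hk : ∑ j, Phi lam W t τ k j < 1) :
    ∑ j, Phi lam W (t + 1) τ i j < 1 := by
  rw [sum_Phi_succ lam W h]
  refine mul_lt_one_of_nonneg_of_lt_one_right (hlam t i).2 (Finset.sum_nonneg fun k _ =>
    mul_nonneg (hW0 t i k) (Finset.sum_nonneg fun j _ =>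
      Phi_nonneg hW0 (fun t i => (hlam t i).1) h k j)) ?_
  exact sum_mul_lt_one (hW0 t i) (hW1 t i) (sum_Phi_le_one hW0 hW1 hlam h) hik hk

/-- A stubborn agent creates a defect of its row sum. -/
lemma sum_Phi_succ_lt_one_of_stubborn (hW0 : ∀ t i j, 0 ≤ W t i j)
    (hW1 : ∀ t i, ∑ j, W t i j = 1) (hlam : ∀ t i, 0 ≤ lam t i ∧ lam t i ≤ 1) {t τ : ℕ}
    (h : τ ≤ t) {i : Fin n} (hi : lam t i < 1) :
    ∑ j, Phi lam W (t + 1) τ i j < 1 := by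
  rw [sum_Phi_succ lam W h]
  refine mul_lt_one_of_nonneg_of_lt_one_left (hlam t i).1 hi ?_
  rw [← hW1 t i]
  exact Finset.sum_le_sum fun k _ =>
    mul_le_of_le_one_right (hW0 t i k) (sum_Phi_le_one hW0 hW1 hlam h k)

/-- After a weakly defected interval every row sum stays below one. -/
lemma sum_Phi_lt_one (hW0 : ∀ t i j, 0 ≤ W t i j) (hW1 : ∀ t i, ∑ j, W t i j = 1)
    (hlam : ∀ t i, 0 ≤ lam t i ∧ lam t i ≤ 1) {t0 t1 t2 td : ℕ} (h01 : t0 ≤ t1)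
    (h12 : t1 < t2) (h2d : t2 ≤ td) (hdef : IsWeaklyDefected lam W t1 t2) (i : Fin n) :
    ∑ j, Phi lam W td t0 i j < 1 := by
  induction td, h2d using Nat.le_induction generalizing i with
  | base =>
    obtain ⟨τ, hτ1, hτ2, a, rfl, hstub, hpath⟩ := hdef i
    have along : ∀ k, τ + 1 ≤ k → k ≤ t2 → ∑ j, Phi lam W k t0 (a k) j < 1 := by
      intro k hk
      induction k, hk using Nat.le_induction with
      | base =>
        intro _
        exact sum_Phi_succ_lt_one_of_stubborn hW0 hW1 hlam (by omega) hstub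
      | succ k hk ih =>
        intro hk2
        exact sum_Phi_succ_lt_one hW0 hW1 hlam (by omega) (hpath k hk hk2) (ih (by omega))
    exact along t2 hτ2 le_rfl
  | succ t h ih =>
    obtain ⟨k, -, hk⟩ : ∃ k ∈ Finset.univ, 0 < W t i k :=
      Finset.exists_lt_of_sum_lt (by simp [hW1])
    exact sum_Phi_succ_lt_one hW0 hW1 hlam (by omega) hk (ih k)

end Stochastic

/-- a weakly defected subinterval forces `‖Φ(t_d,t₀)‖ < 1`. -/
theorem Phi_lt_one_of_weakly_defected {n : ℕ} (hn : 1 ≤ n)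
    (lam : ℕ → Fin n → ℝ) (W : ℕ → Matrix (Fin n) (Fin n) ℝ)
    (hW0 : ∀ t i j, 0 ≤ W t i j) (hW1 : ∀ t i, ∑ j, W t i j = 1)
    (hlam : ∀ t i, 0 ≤ lam t i ∧ lam t i ≤ 1)
    (t0 t1 t2 td : ℕ) (h01 : t0 ≤ t1) (h12 : t1 < t2) (h2d : t2 ≤ td)
    (hdef : IsWeaklyDefected lam W t1 t2) :
    rowNorm (Phi lam W td t0) < 1 := by
  have : Nonempty (Fin n) := ⟨⟨0, hn⟩⟩
  obtain ⟨i, hi⟩ := exists_eq_ciSup_of_finite (f := fun i => ∑ j, |Phi lam W td t0 i j|)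
  rw [rowNorm, ← hi]
  simp only [abs_of_nonneg (Phi_nonneg hW0 (fun t i => (hlam t i).1) (by omega : t0 ≤ td) _ _)]
  exact sum_Phi_lt_one hW0 hW1 hlam h01 h12 h2d hdef i
end
end

section
/- Suppose there is a finite set S of pairs of n×n matrices such that (Λ(t), W(t)) ∈ S for every t ∈ ℕ (as holds in trust-based Friedkin–Johnsen dynamics, where Λ(t) and W(t) are determined by the binary adjacency matrix A(t) ∈ {0,1}^{n×n} and a fixed trust matrix). Suppose moreover that there exist a bound δ ∈ ℕ and infinitely many pairwise disjoint intervals [a_1, b_1), [a_2, b_2), … with a_1 < b_1 ≤ a_2 < b_2 ≤ ⋯, such that each [a_i, b_i) is weakly defected and b_i − a_i ≤ δ. Then ‖Φ(t, 0)‖ → 0 as t → ∞ (the dynamics is asymptotically stable). -/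
open Matrix Finset Filter

noncomputable section

/-- The positive elements of a finite set of reals are bounded below by a positive constant. -/
theorem Set.Finite.exists_pos_le_of_pos {V : Set ℝ} (hV : V.Finite) :
    ∃ ε : ℝ, 0 < ε ∧ ε ≤ 1 ∧ ∀ x ∈ V, 0 < x → ε ≤ x := by
  induction V, hV using Set.Finite.induction_on with
  | empty => exact ⟨1, one_pos, le_rfl, by simp⟩
  | @insert y V _ _ ih =>
    obtain ⟨ε, hε0, hε1, hε⟩ := ih
    by_cases hy : 0 < y
    · refine ⟨min ε y, lt_min hε0 hy, (min_le_left _ _).trans hε1, ?_⟩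
      rintro x (rfl | hx) hx0
      · exact min_le_right _ _
      · exact (min_le_left _ _).trans (hε x hx hx0)
    · refine ⟨ε, hε0, hε1, ?_⟩
      rintro x (rfl | hx) hx0
      · exact absurd hx0 hy
      · exact hε x hx hx0

section RowSums

variable {n : ℕ} {lam : ℕ → Fin n → ℝ} {W : ℕ → Matrix (Fin n) (Fin n) ℝ}

theorem PhiAux_nonneg (hW0 : ∀ t i j, 0 ≤ W t i j) (hlam : ∀ t i, 0 ≤ lam t i ∧ lam t i ≤ 1)
    (τ k : ℕ) (i j : Fin n) : 0 ≤ PhiAux lam W τ k i j := by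
  induction k generalizing i with
  | zero =>
    rw [PhiAux, Matrix.one_apply]
    split_ifs <;> norm_num
  | succ k ih =>
    rw [PhiAux, Matrix.mul_apply]
    refine Finset.sum_nonneg fun l _ => mul_nonneg ?_ (ih l)
    rw [Matrix.diagonal_mul]
    exact mul_nonneg (hlam _ _).1 (hW0 _ _ _)

theorem sum_PhiAux_succ (τ k : ℕ) (i : Fin n) :
    ∑ j, PhiAux lam W τ (k + 1) i j =
      lam (τ + k) i * ∑ l, W (τ + k) i l * ∑ j, PhiAux lam W τ k l j := by
  rw [PhiAux]
  simp_rw [Matrix.mul_apply (N := PhiAux lam W τ k)]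
  rw [Finset.sum_comm, Finset.mul_sum]
  refine Finset.sum_congr rfl fun l _ => ?_
  rw [← Finset.mul_sum, Matrix.diagonal_mul, mul_assoc]

/-- A weighted average of numbers at most `M` is at most `M - w j * (M - x j)` for every `j`. -/
theorem sum_mul_le_sub {w x : Fin n → ℝ} {M : ℝ} (hw0 : ∀ j, 0 ≤ w j) (hw1 : ∑ j, w j = 1)
    (hx : ∀ j, x j ≤ M) (j : Fin n) : ∑ l, w l * x l ≤ M - w j * (M - x j) := by
  have h : w j * (M - x j) ≤ ∑ l, w l * (M - x l) :=
    Finset.single_le_sum (f := fun l => w l * (M - x l))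
      (fun l _ => mul_nonneg (hw0 l) (sub_nonneg.2 (hx l))) (Finset.mem_univ j)
  simp only [mul_sub, Finset.sum_sub_distrib, ← Finset.sum_mul, hw1, one_mul] at h ⊢
  linarith

variable {r : ℕ → Fin n → ℝ}

theorem bound_of_le (hW0 : ∀ t i j, 0 ≤ W t i j) (hW1 : ∀ t i, ∑ j, W t i j = 1)
    (hlam : ∀ t i, 0 ≤ lam t i ∧ lam t i ≤ 1) (hr0 : ∀ t i, 0 ≤ r t i)
    (hr : ∀ t i, r (t + 1) i = lam t i * ∑ l, W t i l * r t l)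
    {s t : ℕ} (hst : s ≤ t) {M : ℝ} (hM : ∀ i, r s i ≤ M) (i : Fin n) : r t i ≤ M := by
  induction t, hst using Nat.le_induction generalizing i with
  | base => exact hM i
  | succ t _ ih =>
    rw [hr]
    have h := sum_mul_le_sub (hW0 t i) (hW1 t i) ih i
    have hp := mul_nonneg (hW0 t i i) (sub_nonneg.2 (ih i))
    have hs : 0 ≤ ∑ l, W t i l * r t l :=
      Finset.sum_nonneg fun l _ => mul_nonneg (hW0 t i l) (hr0 t l)
    exact (mul_le_of_le_one_left hs (hlam t i).2).trans (by linarith)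

/-- A weakly defected interval contracts the bound by a factor `1 - ε ^ δ`. -/
theorem bound_of_isWeaklyDefected (hW0 : ∀ t i j, 0 ≤ W t i j) (hW1 : ∀ t i, ∑ j, W t i j = 1)
    (hlam : ∀ t i, 0 ≤ lam t i ∧ lam t i ≤ 1) (hr0 : ∀ t i, 0 ≤ r t i)
    (hr : ∀ t i, r (t + 1) i = lam t i * ∑ l, W t i l * r t l)
    {ε : ℝ} (hε0 : 0 < ε) (hε1 : ε ≤ 1) (hεW : ∀ t i j, 0 < W t i j → ε ≤ W t i j)
    (hεlam : ∀ t i, lam t i < 1 → ε ≤ 1 - lam t i) {s t δ : ℕ} (hlen : t - s ≤ δ)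
    (hdef : IsWeaklyDefected lam W s t) {M : ℝ} (hM0 : 0 ≤ M) (hM : ∀ i, r s i ≤ M)
    (i : Fin n) : r t i ≤ (1 - ε ^ δ) * M := by
  obtain ⟨τ, hsτ, hτt, p, rfl, hstub, hpath⟩ := hdef i
  have hbd : ∀ k, s ≤ k → ∀ j, r k j ≤ M := fun k hk =>
    bound_of_le hW0 hW1 hlam hr0 hr hk hM
  have hs : ∀ k j, 0 ≤ ∑ l, W k j l * r k l := fun k j =>
    Finset.sum_nonneg fun l _ => mul_nonneg (hW0 k j l) (hr0 k l)
  have key : ∀ k, τ + 1 ≤ k → k ≤ t → r k (p k) ≤ (1 - ε ^ (k - τ)) * M := by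
    intro k hk
    induction k, hk using Nat.le_induction with
    | base =>
      intro _
      rw [hr, Nat.add_sub_cancel_left, pow_one]
      have h := sum_mul_le_sub (hW0 τ (p (τ + 1))) (hW1 τ (p (τ + 1))) (hbd τ hsτ) (p τ)
      have hp := mul_nonneg (hW0 τ (p (τ + 1)) (p τ)) (sub_nonneg.2 (hbd τ hsτ (p τ)))
      have he := hεlam τ _ hstub
      exact mul_le_mul (by linarith) (by linarith) (hs _ _) (by linarith)
    | succ k hk ih =>
      intro hkt
      have ih := ih (by omega)
      rw [hr, show k + 1 - τ = (k - τ) + 1 by omega, pow_succ]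
      have h := sum_mul_le_sub (hW0 k (p (k + 1))) (hW1 k (p (k + 1))) (hbd k (by omega)) (p k)
      have hw := hεW _ _ _ (hpath k hk hkt)
      have hgap : ε * (ε ^ (k - τ) * M) ≤ W k (p (k + 1)) (p k) * (M - r k (p k)) :=
        mul_le_mul hw (by linarith) (by positivity) (hW0 _ _ _)
      refine (mul_le_of_le_one_left (hs _ _) (hlam _ _).2).trans ?_
      linarith
  refine (key t hτt le_rfl).trans (mul_le_mul_of_nonneg_right ?_ hM0)
  have := pow_le_pow_of_le_one hε0.le hε1 (show t - τ ≤ δ by omega)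
  linarith

end RowSums

/-- if the pairs `(Λ(t), W(t))` range over a finite set (as in
trust-based FJ dynamics) and there are infinitely many pairwise disjoint,
uniformly bounded weakly defected intervals, the dynamics is asymptotically
stable. -/
theorem tbfj_asymptotic_stability_of_WDTGs {n : ℕ} (hn : 1 ≤ n)
    (lam : ℕ → Fin n → ℝ) (W : ℕ → Matrix (Fin n) (Fin n) ℝ)
    (hW0 : ∀ t i j, 0 ≤ W t i j) (hW1 : ∀ t i, ∑ j, W t i j = 1)
    (hlam : ∀ t i, 0 ≤ lam t i ∧ lam t i ≤ 1)
    (S : Set (Matrix (Fin n) (Fin n) ℝ × Matrix (Fin n) (Fin n) ℝ))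
    (hSfin : S.Finite)
    (hSmem : ∀ t : ℕ, (Matrix.diagonal (lam t), W t) ∈ S)
    (δ : ℕ) (a b : ℕ → ℕ)
    (hab : ∀ i, a i < b i) (hord : ∀ i, b i ≤ a (i + 1))
    (hlen : ∀ i, b i - a i ≤ δ)
    (hdef : ∀ i, IsWeaklyDefected lam W (a i) (b i)) :
    Filter.Tendsto (fun t => rowNorm (Phi lam W t 0)) Filter.atTop (nhds 0) := by
  have hVfin : ((⋃ i, ⋃ j, (fun P => P.2 i j) '' S) ∪
      ⋃ i, (fun P => 1 - P.1 i i) '' S : Set ℝ).Finite :=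
    (Set.finite_iUnion fun i => Set.finite_iUnion fun j => hSfin.image _).union
      (Set.finite_iUnion fun i => hSfin.image _)
  obtain ⟨ε, hε0, hε1, hε⟩ := hVfin.exists_pos_le_of_pos
  have hεW : ∀ t i j, 0 < W t i j → ε ≤ W t i j := fun t i j h =>
    hε _ (Or.inl (Set.mem_iUnion₂.2 ⟨i, j, _, hSmem t, rfl⟩)) h
  have hεlam : ∀ t i, lam t i < 1 → ε ≤ 1 - lam t i := fun t i h =>
    hε _ (Or.inr (Set.mem_iUnion.2 ⟨i, _, hSmem t, by simp⟩)) (sub_pos.2 h)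
  have hΦ0 := PhiAux_nonneg hW0 hlam 0
  set r : ℕ → Fin n → ℝ := fun t i => ∑ j, PhiAux lam W 0 t i j with hr_def
  have hr0 : ∀ t i, 0 ≤ r t i := fun t i => Finset.sum_nonneg fun j _ => hΦ0 t i j
  have hr : ∀ t i, r (t + 1) i = lam t i * ∑ l, W t i l * r t l := fun t i => by
    simpa only [Nat.zero_add] using sum_PhiAux_succ (lam := lam) (W := W) 0 t i
  have hnorm : ∀ t, rowNorm (Phi lam W t 0) = ⨆ i, r t i := fun t => by
    simp only [rowNorm, Phi, Nat.sub_zero, abs_of_nonneg (hΦ0 t _ _), hr_def]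
  have hq0 : 0 ≤ 1 - ε ^ δ := sub_nonneg.2 (pow_le_one₀ hε0.le hε1)
  have hq1 : 1 - ε ^ δ < 1 := sub_lt_self _ (pow_pos hε0 δ)
  have hbound : ∀ m i, r (a m) i ≤ (1 - ε ^ δ) ^ m := by
    intro m
    induction m with
    | zero =>
      refine bound_of_le hW0 hW1 hlam hr0 hr (Nat.zero_le _) fun i => ?_
      simp [hr_def, PhiAux, Matrix.one_apply]
    | succ m ih =>
      refine bound_of_le hW0 hW1 hlam hr0 hr (hord m) fun i => ?_
      rw [pow_succ']
      exact bound_of_isWeaklyDefected hW0 hW1 hlam hr0 hr hε0 hε1 hεW hεlam (hlen m) (hdef m)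
        (pow_nonneg hq0 m) ih i
  rw [Metric.tendsto_atTop]
  intro e he
  obtain ⟨m, hm⟩ := exists_pow_lt_of_lt_one he hq1
  refine ⟨a m, fun t ht => ?_⟩
  rw [hnorm, Real.dist_eq, sub_zero, abs_of_nonneg (Real.iSup_nonneg (hr0 t))]
  exact (Real.iSup_le (bound_of_le hW0 hW1 hlam hr0 hr ht (hbound m)) (pow_nonneg hq0 m)).trans_lt hm
end
end
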